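/- arXiv:2401.01906 — 8 statements merged into one kernel-verified Lean document; each statement's English description precedes it below -/
import Mathlib

section
/- Let H be a real Hilbert space, r > 0, and let P : H → H be the metric projection onto the closed ball of radius r centered at the origin, given by P(x) = x if ‖x‖ ≤ r and P(x) = (r/‖x‖)·x if ‖x‖ > r. If x̄ ∈ H satisfies ‖x̄‖ > r, then for every y ∈ H the Mordukhovich coderivative of P at x̄ applied to y is the singleton { (r/‖x̄‖)·( y − (⟨y, x̄⟩/‖x̄‖²)·x̄ ) }. -/
open scoped RealInnerProductSpace

/-- The metric projection onto the closed ball of radius `r` centered at the origin. -/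
noncomputable def ballProj {H : Type*} [NormedAddCommGroup H] [InnerProductSpace ℝ H]
    (r : ℝ) (x : H) : H :=
  if ‖x‖ ≤ r then x else (r / ‖x‖) • x

/-- `z ∈ D̂*f(x̄)(y)`, the Mordukhovich (Fréchet) coderivative condition for a continuous map:
`limsup_{u → x̄} [⟪z, u - x̄⟫ - ⟪y, f u - f x̄⟫] / (‖u - x̄‖ + ‖f u - f x̄‖) ≤ 0`. -/
def inCoderiv {H : Type*} [NormedAddCommGroup H] [InnerProductSpace ℝ H]
    (f : H → H) (xbar y z : H) : Prop :=
  ∀ ε > (0 : ℝ), ∃ δ > (0 : ℝ), ∀ u : H, 0 < ‖u - xbar‖ → ‖u - xbar‖ < δ →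
    ⟪z, u - xbar⟫ - ⟪y, f u - f xbar⟫ ≤ ε * (‖u - xbar‖ + ‖f u - f xbar‖)

/-- At a point of Fréchet differentiability the coderivative is the adjoint of the derivative. -/
theorem inCoderiv_iff_of_hasFDerivAt {H : Type*} [NormedAddCommGroup H] [InnerProductSpace ℝ H]
    {f : H → H} {f' : H →L[ℝ] H} {x : H} (hf : HasFDerivAt f f' x) (y z : H) :
    inCoderiv f x y z ↔ ∀ v, ⟪z, v⟫ = ⟪y, f' v⟫ := by
  constructor
  · intro h
    have key : ∀ v, ⟪z, v⟫ - ⟪y, f' v⟫ ≤ 0 := by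
      intro v
      rcases eq_or_ne v 0 with rfl | hv
      · simp
      have hv' : 0 < ‖v‖ := norm_pos_iff.2 hv
      have hd : HasDerivAt (fun t : ℝ => f (x + t • v)) (f' v) 0 := hf.hasLineDerivAt v
      have hs := hd.tendsto_slope_zero_right
      simp only [zero_add, zero_smul, add_zero] at hs
      have bound : ∀ ε > (0 : ℝ), ⟪z, v⟫ - ⟪y, f' v⟫ ≤ ε * (‖v‖ + ‖f' v‖) := by
        intro ε hε
        obtain ⟨δ, hδ, H⟩ := h ε hε
        refine le_of_tendsto_of_tendsto
          (tendsto_const_nhds.sub (tendsto_const_nhds.inner hs))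
          ((tendsto_const_nhds.add hs.norm).const_mul ε) ?_
        filter_upwards [Ioo_mem_nhdsGT (show (0 : ℝ) < δ / ‖v‖ by positivity)] with t ht
        have ht0 : 0 < t := ht.1
        have hn : ‖x + t • v - x‖ = t * ‖v‖ := by
          rw [add_sub_cancel_left, norm_smul, Real.norm_of_nonneg ht0.le]
        have hu := H (x + t • v) (by rw [hn]; positivity)
          (by rw [hn]; exact (lt_div_iff₀ hv').1 ht.2)
        rw [hn, add_sub_cancel_left, inner_smul_right] at hu
        rw [inner_smul_right, norm_smul, Real.norm_of_nonneg (inv_nonneg.2 ht0.le)]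
        have hmul := mul_le_mul_of_nonneg_left hu (inv_nonneg.2 ht0.le)
        field_simp at hmul ⊢
        exact hmul
      refine le_of_forall_pos_le_add fun ε hε => ?_
      have hb := bound (ε / (‖v‖ + ‖f' v‖)) (by positivity)
      rwa [div_mul_cancel₀ _ (by positivity), ← zero_add ε] at hb
    intro v
    have h₁ := key v
    have h₂ := key (-v)
    simp only [map_neg, inner_neg_right] at h₂
    linarith
  · intro h ε hε
    have hc : 0 < ε / (‖y‖ + 1) := by positivity
    obtain ⟨δ, hδ, H⟩ := Metric.eventually_nhds_iff.1 (hf.isLittleO.def hc)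
    refine ⟨δ, hδ, fun u _ hu => ?_⟩
    have hr := H (by rwa [dist_eq_norm] : dist u x < δ)
    calc ⟪z, u - x⟫ - ⟪y, f u - f x⟫ = -⟪y, f u - f x - f' (u - x)⟫ := by
          rw [h, inner_sub_right y (f u - f x)]; ring
      _ ≤ ‖y‖ * ‖f u - f x - f' (u - x)‖ :=
          (neg_le_abs _).trans (abs_real_inner_le_norm _ _)
      _ ≤ (‖y‖ + 1) * (ε / (‖y‖ + 1) * ‖u - x‖) := by gcongr; linarith
      _ = ε * ‖u - x‖ := by field_simp
      _ ≤ ε * (‖u - x‖ + ‖f u - f x‖) := by gcongr; linarith [norm_nonneg (f u - f x)]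

/-- The derivative of the projection onto a ball at a point outside of it. -/
theorem hasFDerivAt_ballProj_of_lt_norm {H : Type*} [NormedAddCommGroup H]
    [InnerProductSpace ℝ H] {r : ℝ} {x : H} (hx₀ : x ≠ 0) (hx : r < ‖x‖) :
    HasFDerivAt (ballProj r)
      ((r / ‖x‖) • (ContinuousLinearMap.id ℝ H -
        ((‖x‖ ^ 2)⁻¹ • innerSL ℝ x).smulRight x)) x := by
  have hn : ‖x‖ ≠ 0 := norm_ne_zero_iff.2 hx₀
  have hnorm : HasFDerivAt (fun u : H => ‖u‖) (‖x‖⁻¹ • innerSL ℝ x) x := by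
    have h := ((hasStrictFDerivAt_norm_sq x).hasFDerivAt.sqrt (by positivity))
    simp only [Real.sqrt_sq (norm_nonneg _)] at h
    convert h using 1
    ext v
    simp
    field_simp
  have hdiv : HasFDerivAt (fun u : H => (r / ‖u‖) • u) _ x :=
    (((hasDerivAt_inv hn).comp_hasFDerivAt x hnorm).const_mul r).smul (hasFDerivAt_id x)
  have heq : ballProj r =ᶠ[nhds x] fun u => (r / ‖u‖) • u := by
    filter_upwards [continuous_norm.continuousAt.eventually_const_lt hx] with u hu
    exact if_neg hu.not_ge
  refine (hdiv.congr_of_eventuallyEq heq).congr_fderiv ?_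
  ext v
  simp only [add_apply, sub_apply,
    smul_apply, ContinuousLinearMap.smulRight_apply,
    ContinuousLinearMap.id_apply, innerSL_apply_apply, Function.comp_apply, smul_eq_mul]
  match_scalars <;> field_simp

/-- if `‖x̄‖ > r`, then `D̂*P_{rB}(x̄)(y)` is the singleton
`{(r/‖x̄‖) • (y - (⟪y, x̄⟫/‖x̄‖²) • x̄)}` for every `y`. -/
theorem coderiv_ballProj_exterior {H : Type*} [NormedAddCommGroup H] [InnerProductSpace ℝ H]
    [CompleteSpace H] (r : ℝ) (hr : 0 < r) (xbar : H) (hx : r < ‖xbar‖) (y z : H) :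
    inCoderiv (ballProj r) xbar y z ↔
      z = (r / ‖xbar‖) • (y - (⟪y, xbar⟫ / ‖xbar‖ ^ 2) • xbar) := by
  have hx₀ : xbar ≠ 0 := norm_pos_iff.1 (hr.trans hx)
  rw [inCoderiv_iff_of_hasFDerivAt (hasFDerivAt_ballProj_of_lt_norm hx₀ hx), ext_iff_inner_right ℝ]
  refine forall_congr' fun v => Eq.congr_right ?_
  simp only [sub_apply, smul_apply,
    ContinuousLinearMap.smulRight_apply, ContinuousLinearMap.id_apply, innerSL_apply_apply,
    smul_eq_mul, inner_smul_left, inner_smul_right, inner_sub_left, inner_sub_right,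
    conj_trivial]
  ring
end

section
/- Let H be a real Hilbert space, r > 0, and let P : H → H be the metric projection onto the closed ball of radius r centered at the origin, given by P(x) = x if ‖x‖ ≤ r and P(x) = (r/‖x‖)·x if ‖x‖ > r. If x̄ ∈ H satisfies ‖x̄‖ = r, then the Mordukhovich coderivative of P at x̄ applied to the zero vector is the singleton {0}; that is, z ∈ D̂*P(x̄)(0) if and only if z = 0. -/
open scoped RealInnerProductSpace

/-- The projection onto the ball of radius `r` at most doubles distances to points of
the sphere of radius `r`. -/
theorem norm_ballProj_sub_le {H : Type*} [NormedAddCommGroup H] [InnerProductSpace ℝ H]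
    {r : ℝ} (hr : 0 < r) {x : H} (hx : ‖x‖ = r) (u : H) :
    ‖ballProj r u - ballProj r x‖ ≤ 2 * ‖u - x‖ := by
  have hfx : ballProj r x = x := by simp [ballProj, hx]
  rw [hfx]
  unfold ballProj
  split_ifs with h
  · linarith [norm_nonneg (u - x)]
  · push Not at h
    have hu : 0 < ‖u‖ := hr.trans h
    have h₁ : ‖(r / ‖u‖) • u - u‖ = ‖u‖ - r := by
      have h₂ : (r / ‖u‖) • u - u = (r / ‖u‖ - 1) • u := by rw [sub_smul, one_smul]
      have h₃ : r / ‖u‖ - 1 ≤ 0 := by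
        rw [sub_nonpos, div_le_one hu]
        exact h.le
      rw [h₂, norm_smul, Real.norm_eq_abs, abs_of_nonpos h₃]
      field_simp
      ring
    have h₄ := norm_sub_le_norm_sub_add_norm_sub ((r / ‖u‖) • u) u x
    have h₅ := norm_sub_norm_le u x
    linarith

/-- if `‖x̄‖ = r`, then `D̂*P_{rB}(x̄)(0) = {0}`. -/
theorem coderiv_ballProj_sphere_zero {H : Type*} [NormedAddCommGroup H] [InnerProductSpace ℝ H]
    [CompleteSpace H] (r : ℝ) (hr : 0 < r) (xbar : H) (hx : ‖xbar‖ = r) (z : H) :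
    inCoderiv (ballProj r) xbar 0 z ↔ z = 0 := by
  constructor
  · intro h
    by_contra hz
    have hz' : 0 < ‖z‖ := norm_pos_iff.mpr hz
    obtain ⟨δ, hδ, hu⟩ := h (‖z‖ / 12) (by positivity)
    have hn : ‖xbar + (δ / (2 * ‖z‖)) • z - xbar‖ = δ / 2 := by
      rw [add_sub_cancel_left, norm_smul, Real.norm_eq_abs, abs_of_pos (by positivity)]
      field_simp
    have hi : ⟪z, xbar + (δ / (2 * ‖z‖)) • z - xbar⟫ = ‖z‖ * δ / 2 := by
      rw [add_sub_cancel_left, real_inner_smul_right, real_inner_self_eq_norm_sq]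
      field_simp
    have hle := norm_ballProj_sub_le hr hx (xbar + (δ / (2 * ‖z‖)) • z)
    have key := hu (xbar + (δ / (2 * ‖z‖)) • z) (by rw [hn]; positivity) (by rw [hn]; linarith)
    rw [inner_zero_left, hi] at key
    rw [hn] at hle key
    nlinarith [mul_le_mul_of_nonneg_left hle hz'.le, mul_pos hz' hδ]
  · rintro rfl ε hε
    refine ⟨1, one_pos, fun u _ _ => ?_⟩
    simp only [inner_zero_left, sub_zero]
    positivity
end

section
/- Let H be a real Hilbert space, r > 0, and let P : H → H be the metric projection onto the closed ball of radius r centered at the origin, given by P(x) = x if ‖x‖ ≤ r and P(x) = (r/‖x‖)·x if ‖x‖ > r. Let x̄ ∈ H satisfy ‖x̄‖ = r and let y ∈ H with y ≠ 0. Then 0 ∈ D̂*P(x̄)(y) if and only if y = (⟨y, x̄⟩/‖x̄‖²)·x̄ with ⟨y, x̄⟩ ≤ 0 (equivalently, y is a nonpositive scalar multiple of x̄, but y ≠ 0 so the scalar is negative). -/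
open scoped RealInnerProductSpace

theorem norm_ballProj_le {H : Type*} [NormedAddCommGroup H] [InnerProductSpace ℝ H]
    {r : ℝ} (hr : 0 ≤ r) (x : H) : ‖ballProj r x‖ ≤ r := by
  unfold ballProj
  split_ifs with h
  · exact h
  · have hx : 0 < ‖x‖ := by linarith
    rw [norm_smul, Real.norm_of_nonneg (by positivity)]
    field_simp
    rfl

/-- A direction pointing strictly into the ball makes a nonnegative inner product with `y`
whenever `0` lies in the coderivative at `y`. -/
theorem inner_nonneg_of_inCoderiv_ballProj_zero {H : Type*} [NormedAddCommGroup H]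
    [InnerProductSpace ℝ H] {r : ℝ} {xbar y v : H} (hx : ‖xbar‖ = r)
    (h : inCoderiv (ballProj r) xbar y 0) (hv : ⟪xbar, v⟫ < 0) : 0 ≤ ⟪y, v⟫ := by
  by_contra! hneg
  have hv0 : 0 < ‖v‖ := by
    rw [norm_pos_iff]
    rintro rfl
    simp at hv
  obtain ⟨δ, hδ, hu⟩ := h (-⟪y, v⟫ / (4 * ‖v‖)) (div_pos (by linarith) (by positivity))
  obtain ⟨t, ht, htδ, htv⟩ : ∃ t > 0, t * ‖v‖ < δ ∧ t * ‖v‖ ^ 2 ≤ -⟪xbar, v⟫ := by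
    refine ⟨min (δ / (2 * ‖v‖)) (-⟪xbar, v⟫ / ‖v‖ ^ 2),
      lt_min (by positivity) (div_pos (by linarith) (by positivity)), ?_, ?_⟩
    · calc _ ≤ δ / (2 * ‖v‖) * ‖v‖ := by gcongr; exact min_le_left _ _
        _ = δ / 2 := by field_simp
        _ < δ := by linarith
    · calc _ ≤ -⟪xbar, v⟫ / ‖v‖ ^ 2 * ‖v‖ ^ 2 := by gcongr; exact min_le_right _ _
        _ = _ := by field_simp
  have hball : ‖xbar + t • v‖ ≤ r := by
    have hsq := norm_add_sq_real xbar (t • v)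
    rw [inner_smul_right, norm_smul, Real.norm_of_nonneg ht.le, hx] at hsq
    refine le_of_sq_le_sq ?_ (hx ▸ norm_nonneg xbar)
    nlinarith
  have hnorm : ‖t • v‖ = t * ‖v‖ := by rw [norm_smul, Real.norm_of_nonneg ht.le]
  have key := hu (xbar + t • v) (by rw [add_sub_cancel_left, hnorm]; positivity)
    (by rwa [add_sub_cancel_left, hnorm])
  rw [ballProj, ballProj, if_pos hball, if_pos hx.le, add_sub_cancel_left, hnorm,
    inner_zero_left, inner_smul_right] at key
  have hε : -⟪y, v⟫ / (4 * ‖v‖) * (t * ‖v‖ + t * ‖v‖) = t * -⟪y, v⟫ / 2 := by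
    field_simp
    ring
  nlinarith

/-- if `‖x̄‖ = r` and `y ≠ 0`, then `0 ∈ D̂*P_{rB}(x̄)(y)` iff
`y = (⟪y, x̄⟫/‖x̄‖²) • x̄` with `⟪y, x̄⟫ ≤ 0`. -/
theorem coderiv_ballProj_sphere_zero_mem {H : Type*} [NormedAddCommGroup H]
    [InnerProductSpace ℝ H] [CompleteSpace H] (r : ℝ) (hr : 0 < r) (xbar : H)
    (hx : ‖xbar‖ = r) (y : H) (hy : y ≠ 0) :
    inCoderiv (ballProj r) xbar y 0 ↔
      y = (⟪y, xbar⟫ / ‖xbar‖ ^ 2) • xbar ∧ ⟪y, xbar⟫ ≤ 0 := by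
  have hx2 : ⟪xbar, xbar⟫ = r ^ 2 := by rw [real_inner_self_eq_norm_sq, hx]
  constructor
  · intro h
    have hle : ⟪y, xbar⟫ ≤ 0 := by
      have := inner_nonneg_of_inCoderiv_ballProj_zero (v := -xbar) hx h
        (by rw [inner_neg_right, hx2]; nlinarith)
      rw [inner_neg_right] at this
      linarith
    refine ⟨?_, hle⟩
    set c := ⟪y, xbar⟫ / ‖xbar‖ ^ 2 with hc
    set w := y - c • xbar with hw
    have hxw : ⟪xbar, w⟫ = 0 := by
      rw [hw, inner_sub_right, inner_smul_right, hx2, hc, hx, real_inner_comm]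
      field_simp
      ring
    have hyw : ⟪y, w⟫ = ‖w‖ ^ 2 := by
      have hy' : y = w + c • xbar := by rw [hw]; abel
      rw [← real_inner_self_eq_norm_sq]
      conv_lhs => rw [hy']
      rw [inner_add_left, inner_smul_left, hxw, mul_zero, add_zero]
    have hs : ∀ s > 0, ‖w‖ ^ 2 ≤ s * -⟪y, xbar⟫ := by
      intro s hs
      have := inner_nonneg_of_inCoderiv_ballProj_zero (v := -w - s • xbar) hx h
        (by
          rw [inner_sub_right, inner_neg_right, hxw, inner_smul_right, hx2]
          have : 0 < s * r ^ 2 := by positivity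
          linarith)
      rw [inner_sub_right, inner_neg_right, hyw, inner_smul_right] at this
      linarith
    have hw0 : ‖w‖ ^ 2 ≤ 0 := by
      refine le_of_forall_pos_le_add fun ε hε => ?_
      have ha : 0 < -⟪y, xbar⟫ + 1 := by linarith
      have := hs (ε / (-⟪y, xbar⟫ + 1)) (by positivity)
      have hε' : ε / (-⟪y, xbar⟫ + 1) * (-⟪y, xbar⟫ + 1) = ε := by field_simp
      have : 0 < ε / (-⟪y, xbar⟫ + 1) := by positivity
      linarith
    have : w = 0 := by
      rw [← norm_eq_zero]
      exact pow_eq_zero_iff two_ne_zero |>.1 (le_antisymm hw0 (sq_nonneg _))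
    exact sub_eq_zero.1 this
  · rintro ⟨hyx, hle⟩ ε hε
    refine ⟨1, one_pos, fun u _ _ => ?_⟩
    have hc : ⟪y, xbar⟫ / ‖xbar‖ ^ 2 ≤ 0 := div_nonpos_of_nonpos_of_nonneg hle (sq_nonneg _)
    have hP : ⟪xbar, ballProj r u - ballProj r xbar⟫ ≤ 0 := by
      have hxx : ballProj r xbar = xbar := if_pos hx.le
      have h1 := real_inner_le_norm xbar (ballProj r u)
      have h2 := norm_ballProj_le hr.le u
      rw [hxx, inner_sub_right, hx2]
      rw [hx] at h1
      nlinarith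
    have hinner : 0 ≤ ⟪y, ballProj r u - ballProj r xbar⟫ := by
      rw [hyx, real_inner_smul_left]
      exact mul_nonneg_of_nonpos_of_nonpos hc hP
    have : 0 ≤ ε * (‖u - xbar‖ + ‖ballProj r u - ballProj r xbar‖) := by positivity
    rw [inner_zero_left]
    linarith
end

section
/- Let H be a real Hilbert space, r > 0, and let P : H → H be the metric projection onto the closed ball of radius r centered at the origin, given by P(x) = x if ‖x‖ ≤ r and P(x) = (r/‖x‖)·x if ‖x‖ > r. If x̄ ∈ H satisfies ‖x̄‖ = r, then the Mordukhovich coderivative of P at x̄ applied to x̄ itself is empty: D̂*P(x̄)(x̄) = ∅; that is, no z ∈ H satisfies the coderivative limsup condition with y = x̄. -/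
open scoped RealInnerProductSpace

/-- if `‖x̄‖ = r`, then `D̂*P_{rB}(x̄)(x̄) = ∅`. -/
theorem coderiv_ballProj_sphere_self_empty {H : Type*} [NormedAddCommGroup H]
    [InnerProductSpace ℝ H] [CompleteSpace H] (r : ℝ) (hr : 0 < r) (xbar : H)
    (hx : ‖xbar‖ = r) (z : H) :
    ¬ inCoderiv (ballProj r) xbar xbar z := by
  intro h
  obtain ⟨δ, hδ, h⟩ := h (r / 4) (by positivity)
  obtain ⟨t, ht, ht1, htδ⟩ : ∃ t : ℝ, 0 < t ∧ t < 1 ∧ t * r < δ := by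
    refine ⟨min (1 / 2) (δ / (2 * r)), by positivity, by
      linarith [min_le_left (1 / 2 : ℝ) (δ / (2 * r))], ?_⟩
    calc min (1 / 2) (δ / (2 * r)) * r ≤ δ / (2 * r) * r := by
          gcongr
          exact min_le_right _ _
      _ = δ / 2 := by field_simp
      _ < δ := by linarith
  have htr : 0 < t * r := by positivity
  have hP : ballProj r xbar = xbar := if_pos hx.le
  have hout : ballProj r ((1 + t) • xbar) = xbar := by
    have hn : ‖(1 + t) • xbar‖ = (1 + t) * r := by
      rw [norm_smul, hx, Real.norm_of_nonneg (by linarith)]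
    rw [ballProj, hn, if_neg (by nlinarith), smul_smul]
    have : r / ((1 + t) * r) * (1 + t) = 1 := by field_simp
    rw [this, one_smul]
  have hin : ballProj r ((1 - t) • xbar) = (1 - t) • xbar := by
    refine if_pos ?_
    rw [norm_smul, hx, Real.norm_of_nonneg (by linarith)]
    nlinarith
  have hdo : (1 + t) • xbar - xbar = t • xbar := by module
  have hdi : (1 - t) • xbar - xbar = (-t) • xbar := by module
  have hno : ‖t • xbar‖ = t * r := by rw [norm_smul, hx, Real.norm_of_nonneg ht.le]
  have hni : ‖(-t) • xbar‖ = t * r := by rw [neg_smul, norm_neg, hno]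
  have houter := h ((1 + t) • xbar) (by rwa [hdo, hno]) (by rwa [hdo, hno])
  have hinner := h ((1 - t) • xbar) (by rwa [hdi, hni]) (by rwa [hdi, hni])
  rw [hout, hP, hdo, hno, sub_self, inner_zero_right, norm_zero, real_inner_smul_right] at houter
  rw [hin, hP, hdi, hni, real_inner_smul_right, real_inner_smul_right,
    real_inner_self_eq_norm_sq, hx] at hinner
  nlinarith [mul_pos htr hr]
end

section
/- Let ℓ² be the real Hilbert space of square-summable sequences indexed by ℕ, and let P : ℓ² → ℓ² be the metric projection onto the positive cone 𝕂 = {x ∈ ℓ² : x_i ≥ 0 for all i}, given coordinatewise by P(x)_i = max(x_i, 0). Let M be a nonempty finite subset of ℕ with complement M̄, and let x̄ ∈ ℓ² satisfy x̄_i > 0 for all i ∈ M and x̄_i = 0 for all i ∉ M. Then for every y ∈ ℓ²: y_i ≥ 0 for all i ∉ M if and only if y ∈ D̂*P(x̄)(y) (y belongs to the Mordukhovich coderivative of P at x̄ applied to y itself). -/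
open scoped RealInnerProductSpace

/-- let `P` be the metric projection of `ℓ²` onto the positive cone, `M` a
nonempty finite subset of `ℕ`, and `x̄ ∈ ℤ_M` (i.e. `x̄ i > 0` for `i ∈ M`, `x̄ i = 0` for
`i ∉ M`). Then for every `y ∈ ℓ²`: `y ∈ 𝕂_{M̄}` iff `y ∈ D̂*P(x̄)(y)`. -/
theorem coderiv_l2_posProj_self_mem_iff (P : lp (fun _ : ℕ => ℝ) 2 → lp (fun _ : ℕ => ℝ) 2)
    (hP : ∀ (x : lp (fun _ : ℕ => ℝ) 2) (i : ℕ), P x i = max (x i) 0)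
    (M : Finset ℕ) (hM : M.Nonempty) (xbar : lp (fun _ : ℕ => ℝ) 2)
    (hxM : ∀ i ∈ M, 0 < xbar i) (hxM' : ∀ i ∉ M, xbar i = 0)
    (y : lp (fun _ : ℕ => ℝ) 2) :
    (∀ i ∉ M, 0 ≤ y i) ↔ inCoderiv P xbar y y := by
  have hxbar : ∀ i, 0 ≤ xbar i := fun i => by
    by_cases h : i ∈ M
    · exact (hxM i h).le
    · exact (hxM' i h).ge
  have hPx : P xbar = xbar := by
    ext i
    rw [hP, max_eq_left (hxbar i)]
  constructor
  · intro hy ε hε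
    obtain ⟨j, hj, hmin⟩ := M.exists_min_image (fun i => xbar i) hM
    refine ⟨xbar j, hxM j hj, fun u _ hu => ?_⟩
    have hle : ⟪y, u - xbar⟫ - ⟪y, P u - P xbar⟫ ≤ 0 := by
      rw [hPx, ← inner_sub_right, sub_sub_sub_cancel_right, lp.inner_eq_tsum]
      refine tsum_nonpos fun i => ?_
      rw [lp.coeFn_sub, Pi.sub_apply, hP, RCLike.inner_apply, conj_trivial, mul_comm]
      by_cases h : i ∈ M
      · have h1 := (lp.norm_apply_le_norm two_ne_zero (u - xbar) i).trans_lt hu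
        rw [lp.coeFn_sub, Pi.sub_apply, Real.norm_eq_abs, abs_lt] at h1
        have h2 := hmin i h
        rw [max_eq_left (by linarith), sub_self, mul_zero]
      · exact mul_nonpos_of_nonneg_of_nonpos (hy i h) (sub_nonpos.2 (le_max_left _ _))
    exact hle.trans (by positivity)
  · intro hc i hi
    refine neg_nonpos.1 (le_of_forall_pos_le_add fun ε hε => ?_)
    obtain ⟨δ, hδ, h⟩ := hc ε hε
    have hnorm : ‖xbar - lp.single 2 i (δ / 2) - xbar‖ = δ / 2 := by
      rw [sub_sub_cancel_left, norm_neg, lp.norm_single two_pos,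
        Real.norm_of_nonneg (by positivity)]
    have hPu : P (xbar - lp.single 2 i (δ / 2)) = xbar := by
      ext k
      rw [hP, lp.coeFn_sub, Pi.sub_apply]
      rcases eq_or_ne k i with rfl | hk
      · rw [lp.single_apply_self, hxM' k hi]
        exact max_eq_right (by linarith)
      · rw [lp.single_apply_ne _ _ _ hk, sub_zero, max_eq_left (hxbar k)]
    have key := h (xbar - lp.single 2 i (δ / 2)) (by rw [hnorm]; positivity)
      (by rw [hnorm]; linarith)
    rw [hnorm, hPu, hPx, sub_self, inner_zero_right, sub_zero, norm_zero, add_zero,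
      sub_sub_cancel_left, inner_neg_right, lp.inner_single_right, RCLike.inner_apply,
      conj_trivial] at key
    nlinarith
end

section
/- Let ℓ² be the real Hilbert space of square-summable sequences indexed by ℕ, and let P : ℓ² → ℓ² be the metric projection onto the positive cone 𝕂 = {x ∈ ℓ² : x_i ≥ 0 for all i}, given coordinatewise by P(x)_i = max(x_i, 0). Let M be a nonempty finite subset of ℕ, and let x̄ ∈ ℓ² satisfy x̄_i > 0 for all i ∈ M and x̄_i = 0 for all i ∉ M. Let y ∈ ℓ² satisfy y_i ≥ 0 for all i ∉ M. Then the Mordukhovich coderivative of P at x̄ applied to y is exactly the set of all z ∈ ℓ² such that z_i = y_i for all i ∈ M and 0 ≤ z_i ≤ y_i for all i ∉ M. In particular, if y_i = 0 for all i ∉ M, then D̂*P(x̄)(y) = {y}. -/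
open scoped RealInnerProductSpace

open Filter Topology in
/-- If `f` moves along a segment leaving `x` in direction `v` linearly with slope `w`, then every
coderivative element `z` at `y` satisfies `⟪z, v⟫ ≤ ⟪y, w⟫`. -/
theorem inCoderiv.inner_le {H : Type*} [NormedAddCommGroup H] [InnerProductSpace ℝ H]
    {f : H → H} {x y z v w : H} {r : ℝ} (h : inCoderiv f x y z) (hv : v ≠ 0) (hr : 0 < r)
    (hf : ∀ t : ℝ, 0 < t → t < r → f (x + t • v) - f x = t • w) :
    ⟪z, v⟫ ≤ ⟪y, w⟫ := by
  have key : ∀ ε > (0 : ℝ), ⟪z, v⟫ - ⟪y, w⟫ ≤ ε * (‖v‖ + ‖w‖) := by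
    intro ε hε
    obtain ⟨δ, hδ, hu⟩ := h ε hε
    have hv' : 0 < ‖v‖ := norm_pos_iff.2 hv
    obtain ⟨t, ht, htlt⟩ := exists_between (lt_min hr (div_pos hδ hv'))
    have htr := htlt.trans_le (min_le_left _ _)
    have htδ := (lt_div_iff₀ hv').1 (htlt.trans_le (min_le_right _ _))
    have := hu (x + t • v)
    simp only [hf t ht htr, add_sub_cancel_left, norm_smul, inner_smul_right, Real.norm_eq_abs,
      abs_of_pos ht] at this
    have := this (by positivity) htδ
    refine le_of_mul_le_mul_left ?_ ht
    linarith
  have hlim : Tendsto (fun ε : ℝ => ε * (‖v‖ + ‖w‖)) (𝓝[>] 0) (𝓝 0) := by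
    have : Tendsto (fun ε : ℝ => ε * (‖v‖ + ‖w‖)) (𝓝 0) (𝓝 (0 * (‖v‖ + ‖w‖))) :=
      tendsto_id.mul_const _
    rw [zero_mul] at this
    exact this.mono_left nhdsWithin_le_nhds
  exact sub_nonpos.1 (ge_of_tendsto hlim (eventually_mem_nhdsWithin.mono key))

/-- Coordinate form of `inCoderiv.inner_le` for maps of `ℓ²` acting coordinatewise. -/
theorem inCoderiv.mul_le_of_coordinatewise {P : lp (fun _ : ℕ => ℝ) 2 → lp (fun _ : ℕ => ℝ) 2}
    {φ : ℝ → ℝ} (hP : ∀ x i, P x i = φ (x i)) {x y z : lp (fun _ : ℕ => ℝ) 2}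
    (h : inCoderiv P x y z) (i : ℕ) {a b r : ℝ} (ha : a ≠ 0) (hr : 0 < r)
    (hφ : ∀ t : ℝ, 0 < t → t < r → φ (x i + t * a) - φ (x i) = t * b) :
    z i * a ≤ y i * b := by
  have hv : (lp.single 2 i a : lp (fun _ : ℕ => ℝ) 2) ≠ 0 := by
    intro h0
    apply ha
    simpa using congrArg (fun g : lp (fun _ : ℕ => ℝ) 2 => g i) h0
  have := h.inner_le (v := lp.single 2 i a) (w := lp.single 2 i b) hv hr (by
    intro t ht htr
    ext j
    simp only [lp.coeFn_sub, Pi.sub_apply, hP]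
    change φ (x j + t * (lp.single 2 i a : lp (fun _ : ℕ => ℝ) 2) j) - φ (x j) =
      t * (lp.single 2 i b : lp (fun _ : ℕ => ℝ) 2) j
    rcases eq_or_ne j i with rfl | hj
    · simpa using hφ t ht htr
    · simp [hj])
  rw [lp.inner_single_right, lp.inner_single_right] at this
  simpa [mul_comm] using this

/-- A vector satisfying the coordinate conditions lies in the coderivative of the projection. -/
theorem inCoderiv_posProj_of_coord {P : lp (fun _ : ℕ => ℝ) 2 → lp (fun _ : ℕ => ℝ) 2}
    (hP : ∀ (x : lp (fun _ : ℕ => ℝ) 2) (i : ℕ), P x i = max (x i) 0)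
    {M : Finset ℕ} (hM : M.Nonempty) {x y z : lp (fun _ : ℕ => ℝ) 2}
    (hxM : ∀ i ∈ M, 0 < x i) (hxM' : ∀ i ∉ M, x i = 0)
    (hz : ∀ i ∈ M, z i = y i) (hz' : ∀ i ∉ M, 0 ≤ z i ∧ z i ≤ y i) :
    inCoderiv P x y z := by
  obtain ⟨k, hk, hmin⟩ := M.exists_min_image (fun i => x i) hM
  intro ε hε
  refine ⟨x k, hxM k hk, fun u _ hu => le_trans ?_ (by positivity : (0 : ℝ) ≤ _)⟩
  rw [sub_nonpos]
  refine hasSum_le (fun i => ?_) (lp.hasSum_inner z (u - x)) (lp.hasSum_inner y (P u - P x))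
  simp only [lp.coeFn_sub, Pi.sub_apply, hP, RCLike.inner_apply, conj_trivial]
  by_cases hi : i ∈ M
  · have hcoord : |u i - x i| < x i := by
      have := lp.norm_apply_le_norm (by norm_num) (u - x) i
      simp only [lp.coeFn_sub, Pi.sub_apply, Real.norm_eq_abs] at this
      linarith [hmin i hi]
    rw [max_eq_left (by linarith [neg_lt_of_abs_lt hcoord]), max_eq_left (hxM i hi).le, hz i hi]
  · obtain ⟨h0, h1⟩ := hz' i hi
    rw [hxM' i hi]
    rcases le_total 0 (u i) with h | h
    · simpa [h] using mul_le_mul_of_nonneg_left h1 h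
    · simpa [h] using mul_nonpos_of_nonpos_of_nonneg h h0

/-- let `P` be the metric projection of `ℓ²` onto the positive cone, `M` a
nonempty finite subset of `ℕ`, `x̄ ∈ ℤ_M`, and `y` with `y i ≥ 0` for all `i ∉ M`. Then
`D̂*P(x̄)(y) = {z : z i = y i for i ∈ M, 0 ≤ z i ≤ y i for i ∉ M}`; in particular, if
`y i = 0` for all `i ∉ M`, then `D̂*P(x̄)(y) = {y}`. -/
theorem coderiv_l2_posProj_description (P : lp (fun _ : ℕ => ℝ) 2 → lp (fun _ : ℕ => ℝ) 2)
    (hP : ∀ (x : lp (fun _ : ℕ => ℝ) 2) (i : ℕ), P x i = max (x i) 0)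
    (M : Finset ℕ) (hM : M.Nonempty) (xbar : lp (fun _ : ℕ => ℝ) 2)
    (hxM : ∀ i ∈ M, 0 < xbar i) (hxM' : ∀ i ∉ M, xbar i = 0)
    (y : lp (fun _ : ℕ => ℝ) 2) (hy : ∀ i ∉ M, 0 ≤ y i) :
    (∀ z : lp (fun _ : ℕ => ℝ) 2,
      inCoderiv P xbar y z ↔ (∀ i ∈ M, z i = y i) ∧ ∀ i ∉ M, 0 ≤ z i ∧ z i ≤ y i) ∧
    ((∀ i ∉ M, y i = 0) →
      ∀ z : lp (fun _ : ℕ => ℝ) 2, inCoderiv P xbar y z ↔ z = y) := by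
  have char : ∀ z : lp (fun _ : ℕ => ℝ) 2,
      inCoderiv P xbar y z ↔ (∀ i ∈ M, z i = y i) ∧ ∀ i ∉ M, 0 ≤ z i ∧ z i ≤ y i := by
    refine fun z => ⟨fun h => ⟨fun i hi => ?_, fun i hi => ?_⟩,
      fun h => inCoderiv_posProj_of_coord hP hM hxM hxM' h.1 h.2⟩
    · have hx := hxM i hi
      have h1 := h.mul_le_of_coordinatewise (φ := fun s => max s 0) hP i (a := 1) (b := 1)
        one_ne_zero hx (by
          intro t ht htr
          simp only [max_eq_left hx.le, max_eq_left (by linarith : 0 ≤ xbar i + t * 1)]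
          ring)
      have h2 := h.mul_le_of_coordinatewise (φ := fun s => max s 0) hP i (a := -1) (b := -1)
        (by norm_num) hx (by
          intro t ht htr
          simp only [max_eq_left hx.le, max_eq_left (by linarith : 0 ≤ xbar i + t * -1)]
          ring)
      linarith
    · have hx := hxM' i hi
      have h1 := h.mul_le_of_coordinatewise (φ := fun s => max s 0) hP i (a := 1) (b := 1)
        one_ne_zero one_pos (by
          intro t ht htr
          simp [hx, ht.le])
      have h2 := h.mul_le_of_coordinatewise (φ := fun s => max s 0) hP i (a := -1) (b := 0)
        (by norm_num) one_pos (by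
          intro t ht htr
          simp [hx, ht.le])
      constructor <;> linarith
  refine ⟨char, fun hy0 z => ?_⟩
  rw [char]
  constructor
  · rintro ⟨hz, hz'⟩
    ext i
    by_cases hi : i ∈ M
    · exact hz i hi
    · exact le_antisymm (hz' i hi).2 (by simpa [hy0 i hi] using (hz' i hi).1)
  · rintro rfl
    exact ⟨fun _ _ => rfl, fun i hi => ⟨hy i hi, le_rfl⟩⟩
end

section
/- Let ℓ² be the real Hilbert space of square-summable sequences indexed by ℕ, and let P : ℓ² → ℓ² be the metric projection onto the positive cone 𝕂 = {x ∈ ℓ² : x_i ≥ 0 for all i}, given coordinatewise by P(x)_i = max(x_i, 0). Let M be a nonempty finite subset of ℕ, and let x̄ ∈ ℓ² satisfy x̄_i > 0 for all i ∈ M and x̄_i = 0 for all i ∉ M. Then P is not Fréchet differentiable at x̄: there is no continuous linear map L : ℓ² → ℓ² such that ‖P(u) − P(x̄) − L(u − x̄)‖ / ‖u − x̄‖ → 0 as u → x̄. -/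
open scoped RealInnerProductSpace

/-- Any coordinatewise positive-part map on `ℓ²` fails to be differentiable at a point with a
vanishing coordinate. -/
theorem not_differentiableAt_posPart_of_coord_eq_zero
    {P : lp (fun _ : ℕ => ℝ) 2 → lp (fun _ : ℕ => ℝ) 2}
    (hP : ∀ (x : lp (fun _ : ℕ => ℝ) 2) (i : ℕ), P x i = max (x i) 0)
    {x : lp (fun _ : ℕ => ℝ) 2} {i : ℕ} (hi : x i = 0) : ¬ DifferentiableAt ℝ P x := by
  intro h
  let e : lp (fun _ : ℕ => ℝ) 2 := lp.single 2 i 1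
  have hline : DifferentiableAt ℝ (fun t : ℝ => x + t • e) 0 := by fun_prop
  have hcomp : DifferentiableAt ℝ (fun t : ℝ => P (x + t • e)) 0 :=
    DifferentiableAt.comp (0 : ℝ) (by simpa using h) hline
  have hcoord : DifferentiableAt ℝ (fun t : ℝ => P (x + t • e) i) 0 :=
    (lp.evalCLM ℝ (fun _ : ℕ => ℝ) 2 i).differentiableAt.comp (0 : ℝ) hcomp
  have hmax (t : ℝ) : P (x + t • e) i = max t 0 := by
    rw [hP, lp.coeFn_add, lp.coeFn_smul, Pi.add_apply, Pi.smul_apply, hi, lp.single_apply_self]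
    simp
  simp only [hmax] at hcoord
  refine not_differentiableAt_abs_zero ?_
  have habs : (abs : ℝ → ℝ) = fun t => 2 * max t 0 - t := by
    funext t
    rcases le_total t 0 with ht | ht
    · simp [abs_of_nonpos, ht]
    · rw [abs_of_nonneg ht, max_eq_left ht]
      ring
  rw [habs]
  exact (hcoord.const_mul 2).sub differentiableAt_id

/-- let `P` be the metric projection of `ℓ²` onto the positive cone, `M` a
nonempty finite subset of `ℕ`, and `x̄ ∈ ℤ_M`. Then `P` is not Fréchet differentiable
at `x̄`. -/
theorem l2_posProj_not_differentiable (P : lp (fun _ : ℕ => ℝ) 2 → lp (fun _ : ℕ => ℝ) 2)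
    (hP : ∀ (x : lp (fun _ : ℕ => ℝ) 2) (i : ℕ), P x i = max (x i) 0)
    (M : Finset ℕ) (hM : M.Nonempty) (xbar : lp (fun _ : ℕ => ℝ) 2)
    (hxM : ∀ i ∈ M, 0 < xbar i) (hxM' : ∀ i ∉ M, xbar i = 0) :
    ¬ ∃ L : lp (fun _ : ℕ => ℝ) 2 →L[ℝ] lp (fun _ : ℕ => ℝ) 2,
        HasFDerivAt P L xbar := by
  rintro ⟨L, hL⟩
  obtain ⟨i, hi⟩ := Infinite.exists_notMem_finset M
  exact not_differentiableAt_posPart_of_coord_eq_zero hP (hxM' i hi) hL.differentiableAt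
end

section
/- Let ℓ² be the real Hilbert space of square-summable sequences indexed by ℕ, and let P : ℓ² → ℓ² be the metric projection onto the positive cone 𝕂 = {x ∈ ℓ² : x_i ≥ 0 for all i}, given coordinatewise by P(x)_i = max(x_i, 0). Let M be a nonempty finite subset of ℕ, and let x̄ ∈ ℓ² satisfy x̄_i > 0 for all i ∈ M and x̄_i = 0 for all i ∉ M. Then for every y ∈ ℓ² with y_i = 0 for all i ∉ M, the Mordukhovich coderivative of P at x̄ applied to y is the singleton {y}; that is, on the finite-dimensional subspace ℝ^M = {y ∈ ℓ² : y_i = 0 for i ∉ M}, the coderivative D̂*P(x̄) acts as the identity. -/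
open scoped RealInnerProductSpace

theorem norm_posProj_sub_le {P : lp (fun _ : ℕ => ℝ) 2 → lp (fun _ : ℕ => ℝ) 2}
    (hP : ∀ (x : lp (fun _ : ℕ => ℝ) 2) (i : ℕ), P x i = max (x i) 0)
    (u v : lp (fun _ : ℕ => ℝ) 2) : ‖P u - P v‖ ≤ ‖u - v‖ :=
  lp.norm_mono two_ne_zero fun i => by
    simpa [hP] using abs_max_sub_max_le_abs (u i) (v i) 0

/-- Near a point that is positive on `M`, the projection looks like the identity when tested
against vectors supported in `M`. -/
theorem exists_inner_posProj_sub_eq {P : lp (fun _ : ℕ => ℝ) 2 → lp (fun _ : ℕ => ℝ) 2}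
    (hP : ∀ (x : lp (fun _ : ℕ => ℝ) 2) (i : ℕ), P x i = max (x i) 0)
    {M : Finset ℕ} (hM : M.Nonempty) {x y : lp (fun _ : ℕ => ℝ) 2}
    (hx : ∀ i ∈ M, 0 < x i) (hy : ∀ i ∉ M, y i = 0) :
    ∃ δ > (0 : ℝ), ∀ u, ‖u - x‖ < δ → ⟪y, P u - P x⟫ = ⟪y, u - x⟫ := by
  obtain ⟨j, hj, hmin⟩ := M.exists_min_image (fun i => x i) hM
  refine ⟨x j, hx j hj, fun u hu => ?_⟩
  rw [lp.inner_eq_tsum, lp.inner_eq_tsum]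
  refine tsum_congr fun i => ?_
  by_cases hi : i ∈ M
  · have hcoord : |u i - x i| ≤ ‖u - x‖ := by
      simpa using lp.norm_apply_le_norm two_ne_zero (u - x) i
    have hui : 0 ≤ u i := by
      have := (abs_le.mp hcoord).1
      linarith [hmin i hi]
    simp [hP, max_eq_left hui, max_eq_left (hx i hi).le]
  · simp [hy i hi]

/-- let `P` be the metric projection of `ℓ²` onto the positive cone, `M` a
nonempty finite subset of `ℕ`, and `x̄ ∈ ℤ_M`. Then for every `y ∈ ℝ^M` (i.e. `y i = 0` for
all `i ∉ M`), `D̂*P(x̄)(y) = {y}`: the coderivative acts as the identity on `ℝ^M`. -/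
theorem coderiv_l2_posProj_identity (P : lp (fun _ : ℕ => ℝ) 2 → lp (fun _ : ℕ => ℝ) 2)
    (hP : ∀ (x : lp (fun _ : ℕ => ℝ) 2) (i : ℕ), P x i = max (x i) 0)
    (M : Finset ℕ) (hM : M.Nonempty) (xbar : lp (fun _ : ℕ => ℝ) 2)
    (hxM : ∀ i ∈ M, 0 < xbar i) (hxM' : ∀ i ∉ M, xbar i = 0)
    (y : lp (fun _ : ℕ => ℝ) 2) (hy : ∀ i ∉ M, y i = 0)
    (z : lp (fun _ : ℕ => ℝ) 2) :
    inCoderiv P xbar y z ↔ z = y := by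
  obtain ⟨r, hr, hlocal⟩ := exists_inner_posProj_sub_eq hP hM hxM hy
  constructor
  · intro h
    by_contra hne
    have hpos : 0 < ‖z - y‖ := norm_pos_iff.mpr (sub_ne_zero.mpr hne)
    obtain ⟨δ, hδ, hbound⟩ := h (‖z - y‖ / 4) (by positivity)
    obtain ⟨t, ht, htlt⟩ := exists_between (show 0 < min δ r / ‖z - y‖ by positivity)
    have hsub : xbar + t • (z - y) - xbar = t • (z - y) := add_sub_cancel_left _ _
    have hnorm : ‖xbar + t • (z - y) - xbar‖ = t * ‖z - y‖ := by
      rw [hsub, norm_smul, Real.norm_of_nonneg ht.le]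
    have hlt : t * ‖z - y‖ < min δ r := (lt_div_iff₀ hpos).mp htlt
    have hle := hbound (xbar + t • (z - y)) (by rw [hnorm]; positivity)
      (by rw [hnorm]; exact hlt.trans_le (min_le_left _ _))
    have hnonexp := norm_posProj_sub_le hP (xbar + t • (z - y)) xbar
    rw [hlocal _ (by rw [hnorm]; exact hlt.trans_le (min_le_right _ _)), ← inner_sub_left,
      hnorm, hsub, real_inner_smul_right, real_inner_self_eq_norm_sq] at hle
    rw [hnorm] at hnonexp
    nlinarith [mul_pos ht (pow_pos hpos 2), mul_le_mul_of_nonneg_left hnonexp hpos.le]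
  · rintro rfl ε hε
    refine ⟨r, hr, fun u _ hu => ?_⟩
    rw [hlocal u hu, sub_self]
    positivity
end
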